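/- Let λ > 0 and ρ ≥ 0, and set ω = √(λ+ρ). Suppose X¹, X² : ℝ → ℝ are twice differentiable with X¹(0) = X²(0) = 0 and satisfy, for all t ∈ ℝ, the system X¹''(t) − √λ·X²'(t) = 0 and X²''(t) + √λ·X¹'(t) + ρ·X²(t) = 0. Then there exist constants A, B ∈ ℝ such that for all t ∈ ℝ: X¹(t) = (√λ/ω)·( A·(1 − cos(ωt)) − B·((ρω/λ)·t + sin(ωt)) ) and X²(t) = A·sin(ωt) + B·(1 − cos(ωt)). -/

import Mathlib

theorem const_aux (f f' : ℝ → ℝ) (h : ∀ t, HasDerivAt f (f' t) t) (h0 : ∀ t, f' t = 0) (t : ℝ) :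
    f t = f 0 :=
  is_const_of_deriv_eq_zero (fun x => (h x).differentiableAt)
    (fun x => (h x).deriv.trans (h0 x)) t 0

/-- Explicit solution of the canonical Jacobi system on the invariant
plane.  Let `l > 0`, `r ≥ 0`, `ω = √(l+r)`.  If `X¹, X² : ℝ → ℝ` are twice
differentiable with `X¹(0) = X²(0) = 0` and satisfy `X¹'' − √l·X²' = 0` and
`X²'' + √l·X¹' + r·X² = 0` on `ℝ`, then there are constants `A, B` with
`X¹(t) = (√l/ω)·(A(1 − cos ωt) − B((rω/l)t + sin ωt))` and
`X²(t) = A sin ωt + B(1 − cos ωt)` for all `t`. -/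
theorem stmt7
    (l r : ℝ) (hl : 0 < l) (hr : 0 ≤ r)
    (ω : ℝ) (hω : ω = Real.sqrt (l + r))
    (X1 X2 : ℝ → ℝ)
    (hX1 : Differentiable ℝ X1) (hX1' : Differentiable ℝ (deriv X1))
    (hX2 : Differentiable ℝ X2) (hX2' : Differentiable ℝ (deriv X2))
    (h10 : X1 0 = 0) (h20 : X2 0 = 0)
    (heq1 : ∀ t : ℝ, deriv (deriv X1) t - Real.sqrt l * deriv X2 t = 0)
    (heq2 : ∀ t : ℝ, deriv (deriv X2) t + Real.sqrt l * deriv X1 t + r * X2 t = 0) :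
    ∃ A B : ℝ, ∀ t : ℝ,
      X1 t = (Real.sqrt l / ω) *
          (A * (1 - Real.cos (ω * t)) - B * ((r * ω / l) * t + Real.sin (ω * t))) ∧
      X2 t = A * Real.sin (ω * t) + B * (1 - Real.cos (ω * t)) := by
  have hs : Real.sqrt l * Real.sqrt l = l := Real.mul_self_sqrt hl.le
  have hw : ω * ω = l + r := by rw [hω]; exact Real.mul_self_sqrt (by linarith)
  have hpos : 0 < ω := by rw [hω]; exact Real.sqrt_pos.mpr (by linarith)
  generalize Real.sqrt l = s at *
  have hne : ω ≠ 0 := hpos.ne'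
  have hlne : l ≠ 0 := hl.ne'
  have d1 : ∀ t, HasDerivAt X1 (deriv X1 t) t := fun t => (hX1 t).hasDerivAt
  have d2 : ∀ t, HasDerivAt X2 (deriv X2 t) t := fun t => (hX2 t).hasDerivAt
  have dd1 : ∀ t, HasDerivAt (deriv X1) (deriv (deriv X1) t) t := fun t => (hX1' t).hasDerivAt
  have dd2 : ∀ t, HasDerivAt (deriv X2) (deriv (deriv X2) t) t := fun t => (hX2' t).hasDerivAt
  have dlin : ∀ t, HasDerivAt (fun t : ℝ => ω * t) ω t := fun t => by
    simpa using (hasDerivAt_id t).const_mul ω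
  have dc : ∀ t, HasDerivAt (fun t : ℝ => Real.cos (ω * t)) (-Real.sin (ω * t) * ω) t :=
    fun t => (dlin t).cos
  have ds : ∀ t, HasDerivAt (fun t : ℝ => Real.sin (ω * t)) (Real.cos (ω * t) * ω) t :=
    fun t => (dlin t).sin
  obtain ⟨c, hc⟩ : ∃ c, c = deriv X1 0 := ⟨_, rfl⟩
  have e1 : ∀ t, deriv X1 t = s * X2 t + c := fun t => by
    have := const_aux _ _ (fun t => (dd1 t).sub ((d2 t).const_mul s)) heq1 t
    simp only [Pi.sub_apply, h20] at this
    rw [hc]; linarith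
  obtain ⟨B, hB⟩ : ∃ B, B * (ω * ω) = -(s * c) := ⟨-(s * c) / (ω * ω), by field_simp⟩
  obtain ⟨A, hA⟩ : ∃ A, A * ω = deriv X2 0 := ⟨deriv X2 0 / ω, by field_simp⟩
  have e2 : ∀ t, deriv (deriv X2) t = -(ω * ω) * (X2 t - B) := fun t => by
    have h := heq2 t
    rw [e1 t] at h
    linear_combination h + X2 t * hw - X2 t * hs - hB
  have P : ∀ t, ω * (X2 t - B) * Real.cos (ω * t) - deriv X2 t * Real.sin (ω * t) = -(ω * B) :=
    fun t => by
      have := const_aux _ _ (fun t => ((((d2 t).sub_const B).const_mul ω).mul (dc t)).sub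
        ((dd2 t).mul (ds t))) (fun t => by rw [e2 t]; ring) t
      simp [h20] at this
      linarith
  have Q : ∀ t, ω * (X2 t - B) * Real.sin (ω * t) + deriv X2 t * Real.cos (ω * t) = A * ω :=
    fun t => by
      have := const_aux _ _ (fun t => ((((d2 t).sub_const B).const_mul ω).mul (ds t)).add
        ((dd2 t).mul (dc t))) (fun t => by rw [e2 t]; ring) t
      simp [h20] at this
      linarith
  have f2 : ∀ t, X2 t = A * Real.sin (ω * t) + B * (1 - Real.cos (ω * t)) := fun t => by
    have h := Real.sin_sq_add_cos_sq (ω * t)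
    apply mul_left_cancel₀ hne
    linear_combination Real.cos (ω * t) * P t + Real.sin (ω * t) * Q t - ω * (X2 t - B) * h
  refine ⟨A, B, fun t => ⟨?_, f2 t⟩⟩
  have dl2 : ∀ t, HasDerivAt (fun t : ℝ => (r * ω / l) * t) (r * ω / l) t := fun t => by
    simpa using (hasDerivAt_id t).const_mul (r * ω / l)
  have := const_aux _ _ (fun t => (d1 t).sub (((((dc t).const_sub 1).const_mul A).sub
    (((dl2 t).add (ds t)).const_mul B)).const_mul (s / ω))) (fun t => by
      rw [e1 t, f2 t]
      field_simp
      linear_combination s * hB - s * B * hw - c * hs) t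
  simp [h10] at this
  linarith
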